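/- For all real numbers a, b, every integer n ≥ 0, and every real x: b·P_n^{(a,b)}(x) + (1+x)·(d/dx)P_n^{(a,b)}(x) = (n+b)·P_n^{(a+1,b−1)}(x), and a·P_n^{(a,b)}(x) − (1−x)·(d/dx)P_n^{(a,b)}(x) = (n+a)·P_n^{(a−1,b+1)}(x). -/

import Mathlib

noncomputable section

/-- Generalized binomial coefficient `C(α, j) = α(α−1)⋯(α−j+1)/j!`. -/
def genBinom (α : ℝ) (j : ℕ) : ℝ :=
  (∏ i ∈ Finset.range j, (α - i)) / (Nat.factorial j)

/-- Jacobi polynomial `P_n^{(a,b)}(x)`; zero for negative `n`. -/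
def jacobiP (n : ℤ) (a b : ℝ) (x : ℝ) : ℝ :=
  if n < 0 then 0 else
    ∑ m ∈ Finset.range (n.toNat + 1),
      genBinom ((n : ℝ) + a) (n.toNat - m) * genBinom ((n : ℝ) + b) m *
        ((x - 1) / 2) ^ m * ((x + 1) / 2) ^ (n.toNat - m)

theorem genBinom_zero (α : ℝ) : genBinom α 0 = 1 := by
  simp [genBinom]

theorem succ_mul_genBinom_succ (α : ℝ) (j : ℕ) :
    ((j : ℝ) + 1) * genBinom α (j + 1) = (α - j) * genBinom α j := by
  have hj : ((j : ℝ) + 1) ≠ 0 := by positivity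
  have hf : (Nat.factorial j : ℝ) ≠ 0 := by positivity
  simp only [genBinom, Finset.prod_range_succ, Nat.factorial_succ]
  push_cast
  field_simp

theorem sub_mul_genBinom (α : ℝ) (j : ℕ) :
    (α - j) * genBinom α j = α * genBinom (α - 1) j := by
  have h : (∏ i ∈ Finset.range j, (α - i)) * (α - j)
      = (∏ i ∈ Finset.range j, (α - 1 - i)) * α := by
    rw [← Finset.prod_range_succ (fun i : ℕ => α - (i : ℝ)), Finset.prod_range_succ']
    simp only [Nat.cast_add, Nat.cast_one, Nat.cast_zero, sub_zero, sub_sub, add_comm]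
  simp only [genBinom]
  linear_combination h / (Nat.factorial j : ℝ)

theorem genBinom_add_one_succ (α : ℝ) (j : ℕ) :
    genBinom (α + 1) (j + 1) = genBinom α (j + 1) + genBinom α j := by
  have hj : ((j : ℝ) + 1) ≠ 0 := by positivity
  have h₁ := succ_mul_genBinom_succ α j
  have h₂ := succ_mul_genBinom_succ (α + 1) j
  have h₃ := sub_mul_genBinom (α + 1) j
  rw [add_sub_cancel_right] at h₃
  apply mul_left_cancel₀ hj
  linear_combination h₂ + h₃ - h₁

/-- The homogeneous form `∑_{i+j=n} C(A,i) C(B,j) uʲ vⁱ` of the Jacobi polynomial. -/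
def jacobiForm (n : ℕ) (A B u v : ℝ) : ℝ :=
  ∑ p ∈ Finset.HasAntidiagonal.antidiagonal n, genBinom A p.1 * genBinom B p.2 * u ^ p.2 * v ^ p.1

/-- The sum `(∂/∂u + ∂/∂v)` of the partial derivatives of `jacobiForm`. -/
def jacobiFormDeriv (n : ℕ) (A B u v : ℝ) : ℝ :=
  ∑ p ∈ Finset.HasAntidiagonal.antidiagonal n, genBinom A p.1 * genBinom B p.2 *
    (p.2 * u ^ (p.2 - 1) * v ^ p.1 + u ^ p.2 * (p.1 * v ^ (p.1 - 1)))

theorem jacobiForm_swap (n : ℕ) (A B u v : ℝ) :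
    jacobiForm n A B u v = jacobiForm n B A v u := by
  unfold jacobiForm
  rw [← Finset.Nat.sum_antidiagonal_swap]
  exact Finset.sum_congr rfl fun p _ => by simp only [Prod.fst_swap, Prod.snd_swap]; ring

theorem jacobiFormDeriv_swap (n : ℕ) (A B u v : ℝ) :
    jacobiFormDeriv n A B u v = jacobiFormDeriv n B A v u := by
  unfold jacobiFormDeriv
  rw [← Finset.Nat.sum_antidiagonal_swap]
  exact Finset.sum_congr rfl fun p _ => by simp only [Prod.fst_swap, Prod.snd_swap]; ring

theorem jacobiForm_ladder (n : ℕ) (A b u v : ℝ) :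
    b * jacobiForm n A (n + b) u v + v * jacobiFormDeriv n A (n + b) u v
      = (n + b) * jacobiForm n (A + 1) (n + b - 1) u v := by
  generalize hB : (n : ℝ) + b = B
  have hsplit : b * jacobiForm n A B u v + v * jacobiFormDeriv n A B u v
      = B * jacobiForm n A (B - 1) u v
        + ∑ p ∈ Finset.HasAntidiagonal.antidiagonal n,
            genBinom A p.1 * (p.2 * genBinom B p.2) * u ^ (p.2 - 1) * v ^ (p.1 + 1) := by
    simp only [jacobiForm, jacobiFormDeriv, Finset.mul_sum, ← Finset.sum_add_distrib]
    refine Finset.sum_congr rfl ?_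
    rintro ⟨i, j⟩ hp
    rw [Finset.HasAntidiagonal.mem_antidiagonal] at hp
    have hb : b = B - i - j := by rw [← hB, ← hp]; push_cast; ring
    have hv : (i : ℝ) * v ^ (i - 1) * v = i * v ^ i := by
      cases i with
      | zero => simp
      | succ i => simp only [Nat.add_sub_cancel]; ring
    have h := sub_mul_genBinom B j
    simp only [hb]
    linear_combination genBinom A i * u ^ j * v ^ i * h + genBinom A i * genBinom B j * u ^ j * hv
  rw [hsplit]
  cases n with
  | zero => simp [jacobiForm, genBinom_zero]
  | succ k =>
    rw [Finset.Nat.sum_antidiagonal_succ']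
    simp only [jacobiForm, Finset.Nat.sum_antidiagonal_succ, genBinom_zero, Nat.cast_zero,
      zero_mul, mul_zero, mul_add, Finset.mul_sum, add_assoc, Nat.add_sub_cancel, zero_add,
      ← Finset.sum_add_distrib]
    congr 1
    refine Finset.sum_congr rfl fun p _ => ?_
    have h₁ := succ_mul_genBinom_succ B p.2
    have h₂ := sub_mul_genBinom B p.2
    rw [genBinom_add_one_succ]
    push_cast
    linear_combination genBinom A p.1 * u ^ p.2 * v ^ (p.1 + 1) * (h₁ + h₂)

theorem jacobiP_natCast (n : ℕ) (a b x : ℝ) :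
    jacobiP n a b x = jacobiForm n (n + a) (n + b) ((x - 1) / 2) ((x + 1) / 2) := by
  rw [jacobiForm_swap, jacobiForm, Finset.Nat.sum_antidiagonal_eq_sum_range_succ_mk]
  simp only [jacobiP, Int.natCast_nonneg, not_lt.mpr, if_false, Int.toNat_natCast, Int.cast_natCast]
  exact Finset.sum_congr rfl fun m _ => by ring

theorem hasDerivAt_jacobiP (n : ℕ) (a b x : ℝ) :
    HasDerivAt (jacobiP n a b)
      (jacobiFormDeriv n (n + a) (n + b) ((x - 1) / 2) ((x + 1) / 2) / 2) x := by
  rw [funext (jacobiP_natCast n a b)]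
  unfold jacobiForm jacobiFormDeriv
  rw [Finset.sum_div]
  refine HasDerivAt.fun_sum fun p _ => ?_
  have hu : HasDerivAt (fun y : ℝ => (y - 1) / 2) (1 / 2) x :=
    ((hasDerivAt_id x).sub_const 1).div_const 2
  have hv : HasDerivAt (fun y : ℝ => (y + 1) / 2) (1 / 2) x :=
    ((hasDerivAt_id x).add_const 1).div_const 2
  refine (((hu.fun_pow p.2).const_mul (genBinom (n + a) p.1 * genBinom (n + b) p.2)).fun_mul
    (hv.fun_pow p.1)).congr_deriv ?_
  ring

theorem jacobi_ladder_L6 (a b : ℝ) (n : ℤ) (hn : 0 ≤ n) (x : ℝ) :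
    b * jacobiP n a b x + (1 + x) * deriv (jacobiP n a b) x
      = ((n : ℝ) + b) * jacobiP n (a + 1) (b - 1) x ∧
    a * jacobiP n a b x - (1 - x) * deriv (jacobiP n a b) x
      = ((n : ℝ) + a) * jacobiP n (a - 1) (b + 1) x := by
  lift n to ℕ using hn
  rw [(hasDerivAt_jacobiP n a b x).deriv]
  simp only [jacobiP_natCast, Int.cast_natCast]
  constructor
  · have h := jacobiForm_ladder n (n + a) b ((x - 1) / 2) ((x + 1) / 2)
    rw [← add_assoc, ← add_sub_assoc]
    linear_combination h
  · have h := jacobiForm_ladder n (n + b) a ((x + 1) / 2) ((x - 1) / 2)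
    rw [jacobiForm_swap n (n + b) (n + a), jacobiFormDeriv_swap,
      jacobiForm_swap n (n + b + 1)] at h
    rw [← add_assoc, ← add_sub_assoc]
    linear_combination h
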